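/- For reals p̃ > q̃ > 0 and α, β > 0, the supremum over all t ∈ ℝ of the function f(t) = α(t·p̃ + (1−t)·q̃ − p̃^t·q̃^(1−t)) + β(t·q̃ + (1−t)·p̃ − q̃^t·p̃^(1−t)) equals the supremum of f over t ∈ [0,1]; that is, restricting the supremum defining the Chernoff–Hellinger divergence to [0,1] loses nothing. -/

import Mathlib

/-- For weights `t ≥ 1`, the weighted geometric mean dominates the arithmetic one. -/
theorem arith_le_geom_of_one_le {x y t : ℝ} (hx : 0 < x) (hy : 0 < y) (ht : 1 ≤ t) :
    t * x + (1 - t) * y ≤ x ^ t * y ^ (1 - t) := by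
  have h := one_add_mul_self_le_rpow_one_add (s := x / y - 1)
    (by linarith [div_pos hx hy]) ht
  rw [add_sub_cancel, Real.div_rpow hx.le hy.le] at h
  rw [Real.rpow_sub hy, Real.rpow_one]
  calc t * x + (1 - t) * y = y * (1 + t * (x / y - 1)) := by field_simp; ring
    _ ≤ y * (x ^ t / y ^ t) := by gcongr
    _ = x ^ t * (y / y ^ t) := by ring

/-- For weights `t` outside the open unit interval, the weighted geometric mean dominates the arithmetic one. -/
theorem arith_le_geom_of_notMem_Ioo {x y t : ℝ} (hx : 0 < x) (hy : 0 < y)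
    (ht : t ∉ Set.Ioo 0 1) :
    t * x + (1 - t) * y ≤ x ^ t * y ^ (1 - t) := by
  rcases le_or_gt t 0 with h | h
  · have := arith_le_geom_of_one_le hy hx (t := 1 - t) (by linarith)
    rw [sub_sub_cancel] at this
    linarith
  · exact arith_le_geom_of_one_le hx hy (not_lt.1 fun h' => ht ⟨h, h'⟩)


/-- Restricting the supremum defining the Chernoff–Hellinger divergence to `[0,1]`
loses nothing: the supremum of the CH-divergence integrand over all of `ℝ` equals
its supremum over `t ∈ [0,1]`. -/
theorem Dplus_sup_restrict (p q a b : ℝ) (hq : 0 < q) (hqp : q < p)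
    (ha : 0 < a) (hb : 0 < b) :
    sSup (Set.range (fun t : ℝ =>
        a * (t * p + (1 - t) * q - p ^ t * q ^ (1 - t)) +
        b * (t * q + (1 - t) * p - q ^ t * p ^ (1 - t)))) =
    sSup ((fun t : ℝ =>
        a * (t * p + (1 - t) * q - p ^ t * q ^ (1 - t)) +
        b * (t * q + (1 - t) * p - q ^ t * p ^ (1 - t))) '' Set.Icc 0 1) := by
  have hp : 0 < p := hq.trans hqp
  set f : ℝ → ℝ := fun t =>
    a * (t * p + (1 - t) * q - p ^ t * q ^ (1 - t)) +
    b * (t * q + (1 - t) * p - q ^ t * p ^ (1 - t)) with hf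
  have f_zero : f 0 = 0 := by simp [hf]
  have f_nonpos (t : ℝ) (ht : t ∉ Set.Icc 0 1) : f t ≤ 0 := by
    have ht' : t ∉ Set.Ioo 0 1 := fun h => ht (Set.Ioo_subset_Icc_self h)
    exact add_nonpos
      (mul_nonpos_of_nonneg_of_nonpos ha.le
        (sub_nonpos.2 (arith_le_geom_of_notMem_Ioo hp hq ht')))
      (mul_nonpos_of_nonneg_of_nonpos hb.le
        (sub_nonpos.2 (arith_le_geom_of_notMem_Ioo hq hp ht')))
  have f_cont : Continuous f := by
    have hp' := hp.ne'
    have hq' := hq.ne'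
    have h_rpow {x : ℝ} (hx : x ≠ 0) : Continuous fun t : ℝ => x ^ t :=
      Real.continuous_const_rpow hx
    have h_rpow_sub {x : ℝ} (hx : x ≠ 0) : Continuous fun t : ℝ => x ^ (1 - t) :=
      (h_rpow hx).comp (continuous_const.sub continuous_id)
    have := h_rpow hp'
    have := h_rpow hq'
    have := h_rpow_sub hp'
    have := h_rpow_sub hq'
    fun_prop
  have bdd : BddAbove (f '' Set.Icc 0 1) := isCompact_Icc.bddAbove_image f_cont.continuousOn
  have le_sup (t : ℝ) : f t ≤ sSup (f '' Set.Icc 0 1) := by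
    by_cases ht : t ∈ Set.Icc 0 1
    · exact le_csSup bdd (Set.mem_image_of_mem f ht)
    · exact (f_nonpos t ht).trans (le_csSup bdd ⟨0, by simp, f_zero⟩)
  apply le_antisymm
  · exact csSup_le (Set.range_nonempty f) (Set.forall_mem_range.2 le_sup)
  · exact csSup_le_csSup ⟨_, Set.forall_mem_range.2 le_sup⟩
      ((Set.nonempty_Icc.2 zero_le_one).image f) (Set.image_subset_range _ _)
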